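/- (Eastwood's formula, the paper's equation (defboxk), in the flat model.) Let k ≥ 1 be an integer and let f be a smooth function on ℝ^N ∖ {0} homogeneous of weight k − n/2. For a tuple of indices A_1, …, A_{k−1} ∈ Fin N define f_0 = f and f_j = (D^{(k−j+1−n/2)} f_{j−1})_{A_j} for 1 ≤ j ≤ k−1; set u_{k−1}(A_1, …, A_{k−1}) = Δ f_{k−1} (homogeneous of weight −1 − n/2); then for j = k−1 down to 1 define u_{j−1}(A_1, …, A_{j−1}) = Σ_{B,C} h^{BC} · (D^{(j−k−n/2)} u_j(A_1, …, A_{j−1}, B))_C, i.e. successively apply one more D and contract it against the innermost remaining index using h (note u_j is homogeneous of weight j − k − n/2). Then the resulting function u_0 satisfies u_0 = (∏_{i=2}^{k} (n − 2i)(i − 1)) · Δ^k f + O(Q); that is, the full contraction D^{A_1}⋯D^{A_{k−1}} Δ D_{A_{k−1}}⋯D_{A_1} f equals (∏_{i=2}^{k} (n−2i)(i−1)) Δ^k f up to a term divisible by Q. -/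

import Mathlib

open scoped BigOperators

/-- Partial derivative in the `A`-th coordinate direction. -/
noncomputable def pd {N : ℕ} (A : Fin N) (f : (Fin N → ℝ) → ℝ) : (Fin N → ℝ) → ℝ :=
  fun x => fderiv ℝ f x (Pi.single A 1)

/-- Ambient Laplacian `Δf = ∑_{A,B} h^{AB} ∂_A ∂_B f` w.r.t. the inverse metric `hInv`. -/
noncomputable def lap {N : ℕ} (hInv : Matrix (Fin N) (Fin N) ℝ)
    (f : (Fin N → ℝ) → ℝ) : (Fin N → ℝ) → ℝ :=
  fun x => ∑ A : Fin N, ∑ B : Fin N, hInv A B * pd A (pd B f) x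

/-- `X_A(x) = ∑_B h_{AB} x^B`. -/
def Xc {N : ℕ} (h : Matrix (Fin N) (Fin N) ℝ) (A : Fin N) : (Fin N → ℝ) → ℝ :=
  fun x => ∑ B : Fin N, h A B * x B

/-- `Q(x) = ∑_{A,B} h_{AB} x^A x^B`. -/
def Qfun {N : ℕ} (h : Matrix (Fin N) (Fin N) ℝ) : (Fin N → ℝ) → ℝ :=
  fun x => ∑ A : Fin N, ∑ B : Fin N, h A B * x A * x B

/-- Smooth (C^∞) on `ℝ^N ∖ {0}`. -/
def SmoothOffZero {N : ℕ} (f : (Fin N → ℝ) → ℝ) : Prop :=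
  ContDiffOn ℝ (⊤ : ℕ∞) f {x : Fin N → ℝ | x ≠ 0}

/-- Homogeneous of weight `w` on `ℝ^N ∖ {0}`. -/
def Homog {N : ℕ} (w : ℝ) (f : (Fin N → ℝ) → ℝ) : Prop :=
  ∀ x : Fin N → ℝ, x ≠ 0 → (∑ A : Fin N, x A * pd A f x) = w * f x

/-- Ambient tractor-D operator at weight `w`: `(D^{(w)} f)_A = (n+2w−2)∂_A f − X_A Δf`. -/
noncomputable def Dop {N : ℕ} (n : ℕ) (h hInv : Matrix (Fin N) (Fin N) ℝ) (w : ℝ)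
    (f : (Fin N → ℝ) → ℝ) (A : Fin N) : (Fin N → ℝ) → ℝ :=
  fun x => ((n : ℝ) + 2 * w - 2) * pd A f x - Xc h A x * lap hInv f x

/-- Iterated tractor-D: `seqD … w0 f A 0 = f` and
`seqD … w0 f A (j+1) = (D^{(w0−j)} (seqD … w0 f A j))_{A (j+1)}`. -/
noncomputable def seqD {N : ℕ} (n : ℕ) (h hInv : Matrix (Fin N) (Fin N) ℝ)
    (w0 : ℝ) (f : (Fin N → ℝ) → ℝ) (A : ℕ → Fin N) : ℕ → (Fin N → ℝ) → ℝ
  | 0 => f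
  | j + 1 => Dop n h hInv (w0 - (j : ℝ)) (seqD n h hInv w0 f A j) (A (j + 1))

/-- `u` is `O(Q^m)`: `u = Q^m · g` for some smooth `g` on `ℝ^N ∖ {0}`. -/
def BigOQ {N : ℕ} (h : Matrix (Fin N) (Fin N) ℝ) (m : ℕ) (u : (Fin N → ℝ) → ℝ) : Prop :=
  ∃ g : (Fin N → ℝ) → ℝ, SmoothOffZero g ∧
    ∀ x : Fin N → ℝ, x ≠ 0 → u x = (Qfun h x) ^ m * g x

/-- The downward contraction sequence in Eastwood's formula: `Vseq … 0 A = u_{k−1}(A)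
= Δ (D⋯D f)` (using indices `A 1, …, A (k−1)`), and `Vseq … (i+1) A = u_{k−2−i}(A)` is
obtained from `u_{k−1−i}` by applying one more `D` (at weight `(k−1−i) − k − n/2`) in the
last index slot (position `k−1−i`) and contracting it against the new `D` index with `h⁻¹`. -/
noncomputable def Vseq {N : ℕ} (n k : ℕ) (h hInv : Matrix (Fin N) (Fin N) ℝ)
    (f : (Fin N → ℝ) → ℝ) : ℕ → (ℕ → Fin N) → (Fin N → ℝ) → ℝ
  | 0, A => lap hInv (seqD n h hInv ((k : ℝ) - (n : ℝ) / 2) f A (k - 1))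
  | i + 1, A => fun x => ∑ B : Fin N, ∑ C : Fin N,
      hInv B C *
        Dop n h hInv (-1 - (i : ℝ) - (n : ℝ) / 2)
          (Vseq n k h hInv f i (Function.update A (k - 1 - i) B)) C x

lemma isOpen_ne_zero {N : ℕ} : IsOpen {x : Fin N → ℝ | x ≠ 0} := isOpen_ne

namespace SmoothOffZero

variable {N : ℕ} {f g : (Fin N → ℝ) → ℝ}

lemma contDiffAt (hf : SmoothOffZero f) {x : Fin N → ℝ} (hx : x ≠ 0) :
    ContDiffAt ℝ (⊤ : ℕ∞) f x :=
  ContDiffOn.contDiffAt hf (isOpen_ne_zero.mem_nhds hx)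

lemma differentiableAt (hf : SmoothOffZero f) {x : Fin N → ℝ} (hx : x ≠ 0) :
    DifferentiableAt ℝ f x :=
  (hf.contDiffAt hx).differentiableAt (by simp)

lemma add (hf : SmoothOffZero f) (hg : SmoothOffZero g) :
    SmoothOffZero (fun x => f x + g x) :=
  ContDiffOn.add hf hg

lemma sub (hf : SmoothOffZero f) (hg : SmoothOffZero g) :
    SmoothOffZero (fun x => f x - g x) :=
  ContDiffOn.sub hf hg

lemma mul (hf : SmoothOffZero f) (hg : SmoothOffZero g) :
    SmoothOffZero (fun x => f x * g x) :=
  ContDiffOn.mul hf hg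

lemma const (c : ℝ) : SmoothOffZero (fun _ : Fin N → ℝ => c) :=
  contDiffOn_const

lemma sum {ι : Type*} {s : Finset ι} {F : ι → (Fin N → ℝ) → ℝ}
    (hF : ∀ i ∈ s, SmoothOffZero (F i)) : SmoothOffZero (fun x => ∑ i ∈ s, F i x) :=
  ContDiffOn.sum hF

lemma coord (B : Fin N) : SmoothOffZero (fun x : Fin N → ℝ => x B) :=
  (contDiff_apply ℝ ℝ B).contDiffOn

lemma xc (h : Matrix (Fin N) (Fin N) ℝ) (A : Fin N) : SmoothOffZero (Xc h A) :=
  sum fun B _ => (const _).mul (coord B)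

lemma qfun (h : Matrix (Fin N) (Fin N) ℝ) : SmoothOffZero (Qfun h) :=
  sum fun A _ => sum fun B _ => ((const _).mul (coord A)).mul (coord B)

lemma pd (hf : SmoothOffZero f) (A : Fin N) : SmoothOffZero (pd A f) :=
  (ContDiffOn.fderiv_of_isOpen hf isOpen_ne_zero (by simp)).clm_apply contDiffOn_const

lemma lap (hf : SmoothOffZero f) (hInv : Matrix (Fin N) (Fin N) ℝ) :
    SmoothOffZero (lap hInv f) :=
  sum fun A _ => sum fun B _ => (const _).mul ((hf.pd B).pd A)

lemma lap_iterate (hf : SmoothOffZero f) (hInv : Matrix (Fin N) (Fin N) ℝ) (m : ℕ) :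
    SmoothOffZero ((_root_.lap hInv)^[m] f) := by
  induction m with
  | zero => exact hf
  | succ m ih => rw [Function.iterate_succ_apply']; exact ih.lap hInv

lemma dop (hf : SmoothOffZero f) (n : ℕ) (h hInv : Matrix (Fin N) (Fin N) ℝ) (w : ℝ)
    (A : Fin N) : SmoothOffZero (Dop n h hInv w f A) :=
  ((const _).mul (hf.pd A)).sub ((xc h A).mul (hf.lap hInv))

lemma seqD (hf : SmoothOffZero f) (n : ℕ) (h hInv : Matrix (Fin N) (Fin N) ℝ) (w : ℝ)
    (A : ℕ → Fin N) (j : ℕ) : SmoothOffZero (seqD n h hInv w f A j) := by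
  induction j with
  | zero => exact hf
  | succ j ih => exact ih.dop n h hInv _ _

end SmoothOffZero

section Calculus

variable {N : ℕ} {f g : (Fin N → ℝ) → ℝ} {x : Fin N → ℝ}

lemma pd_congr (hfg : ∀ y : Fin N → ℝ, y ≠ 0 → f y = g y) (hx : x ≠ 0) (A : Fin N) :
    pd A f x = pd A g x := by
  have : f =ᶠ[nhds x] g := Filter.eventually_of_mem (isOpen_ne_zero.mem_nhds hx) hfg
  simp only [pd, this.fderiv_eq]

lemma lap_congr (hInv : Matrix (Fin N) (Fin N) ℝ)
    (hfg : ∀ y : Fin N → ℝ, y ≠ 0 → f y = g y) (hx : x ≠ 0) :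
    lap hInv f x = lap hInv g x := by
  simp only [lap]
  exact Finset.sum_congr rfl fun A _ => Finset.sum_congr rfl fun B _ => by
    rw [pd_congr (fun y hy => pd_congr hfg hy B) hx]

lemma pd_add (hf : SmoothOffZero f) (hg : SmoothOffZero g) (hx : x ≠ 0) (A : Fin N) :
    pd A (fun y => f y + g y) x = pd A f x + pd A g x := by
  simp only [pd, fderiv_fun_add (hf.differentiableAt hx) (hg.differentiableAt hx),
    add_apply]

lemma pd_mul (hf : SmoothOffZero f) (hg : SmoothOffZero g) (hx : x ≠ 0) (A : Fin N) :
    pd A (fun y => f y * g y) x = f x * pd A g x + g x * pd A f x := by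
  simp [pd, fderiv_fun_mul (hf.differentiableAt hx) (hg.differentiableAt hx)]

@[simp]
lemma pd_const (c : ℝ) (A : Fin N) : pd A (fun _ => c) x = 0 := by
  simp [pd]

lemma pd_const_mul (c : ℝ) (hf : SmoothOffZero f) (hx : x ≠ 0) (A : Fin N) :
    pd A (fun y => c * f y) x = c * pd A f x := by
  rw [pd_mul (.const c) hf hx]; simp

lemma pd_sum {ι : Type*} {s : Finset ι} {F : ι → (Fin N → ℝ) → ℝ}
    (hF : ∀ i ∈ s, SmoothOffZero (F i)) (hx : x ≠ 0) (A : Fin N) :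
    pd A (fun y => ∑ i ∈ s, F i y) x = ∑ i ∈ s, pd A (F i) x := by
  simp only [pd, fderiv_fun_sum fun i hi => (hF i hi).differentiableAt hx,
    sum_apply]

lemma pd_comm (hf : SmoothOffZero f) (hx : x ≠ 0) (A B : Fin N) :
    pd A (pd B f) x = pd B (pd A f) x := by
  have hd : DifferentiableAt ℝ (fderiv ℝ f) x :=
    ((hf.contDiffAt hx).fderiv_right (m := 1) (by norm_cast)).differentiableAt (by simp)
  have key : ∀ C D : Fin N, pd C (pd D f) x
      = fderiv ℝ (fderiv ℝ f) x (Pi.single C 1) (Pi.single D 1) := fun C D => by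
    unfold pd
    rw [fderiv_clm_apply hd (differentiableAt_const _)]
    simp
  rw [key, key]
  exact (hf.contDiffAt hx).isSymmSndFDerivAt
    (by rw [minSmoothness_of_isRCLikeNormedField]; norm_cast) _ _

lemma pd_coord (A B : Fin N) : pd A (fun y => y B) x = if B = A then 1 else 0 := by
  have : fderiv ℝ (fun y : Fin N → ℝ => y B) x = ContinuousLinearMap.proj B :=
    (ContinuousLinearMap.proj (R := ℝ) (φ := fun _ : Fin N => ℝ) B).fderiv
  simp [pd, this, Pi.single_apply]

lemma pd_Xc (h : Matrix (Fin N) (Fin N) ℝ) (hx : x ≠ 0) (A B : Fin N) :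
    pd A (Xc h B) x = h B A := by
  unfold Xc
  rw [pd_sum (fun C _ => (SmoothOffZero.const _).mul (.coord C)) hx]
  simp only [pd_const_mul _ (SmoothOffZero.coord _) hx, pd_coord]
  simp

lemma Qfun_eq_sum_mul_Xc (h : Matrix (Fin N) (Fin N) ℝ) (x : Fin N → ℝ) :
    Qfun h x = ∑ A, x A * Xc h A x := by
  simp only [Qfun, Xc, Finset.mul_sum]
  exact Finset.sum_congr rfl fun A _ => Finset.sum_congr rfl fun B _ => by ring

lemma pd_Qfun {h : Matrix (Fin N) (Fin N) ℝ} (hSymm : ∀ A B, h A B = h B A) (hx : x ≠ 0)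
    (A : Fin N) : pd A (Qfun h) x = 2 * Xc h A x := by
  rw [pd_congr (fun y _ => Qfun_eq_sum_mul_Xc h y) hx,
    pd_sum (fun C _ => (SmoothOffZero.coord C).mul (.xc h C)) hx]
  simp only [pd_mul (SmoothOffZero.coord _) (SmoothOffZero.xc h _) hx, pd_coord, pd_Xc h hx,
    Finset.sum_add_distrib]
  have : ∑ C, x C * h C A = Xc h A x :=
    Finset.sum_congr rfl fun C _ => by rw [hSymm C A, mul_comm]
  rw [this]
  simp
  ring

variable (hInv : Matrix (Fin N) (Fin N) ℝ)

lemma lap_add (hf : SmoothOffZero f) (hg : SmoothOffZero g) (hx : x ≠ 0) :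
    lap hInv (fun y => f y + g y) x = lap hInv f x + lap hInv g x := by
  simp only [lap, ← Finset.sum_add_distrib]
  refine Finset.sum_congr rfl fun A _ => Finset.sum_congr rfl fun B _ => ?_
  rw [pd_congr (fun y hy => pd_add hf hg hy B) hx, pd_add (hf.pd B) (hg.pd B) hx]
  ring

lemma lap_const_mul (c : ℝ) (hf : SmoothOffZero f) (hx : x ≠ 0) :
    lap hInv (fun y => c * f y) x = c * lap hInv f x := by
  simp only [lap, Finset.mul_sum]
  refine Finset.sum_congr rfl fun A _ => Finset.sum_congr rfl fun B _ => ?_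
  rw [pd_congr (fun y hy => pd_const_mul c hf hy B) hx, pd_const_mul c (hf.pd B) hx]
  ring

lemma lap_sub (hf : SmoothOffZero f) (hg : SmoothOffZero g) (hx : x ≠ 0) :
    lap hInv (fun y => f y - g y) x = lap hInv f x - lap hInv g x := by
  have : (fun y => f y - g y) = fun y => f y + (-1) * g y := by ext; ring
  rw [this, lap_add hInv hf ((SmoothOffZero.const _).mul hg) hx, lap_const_mul hInv _ hg hx]
  ring

lemma pd_lap (hf : SmoothOffZero f) (hx : x ≠ 0) (C : Fin N) :
    pd C (lap hInv f) x = lap hInv (pd C f) x := by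
  have sB : ∀ A B, SmoothOffZero (fun y => hInv A B * pd A (pd B f) y) := fun A B =>
    (SmoothOffZero.const _).mul ((hf.pd B).pd A)
  unfold lap
  rw [pd_sum (fun A _ => .sum fun B _ => sB A B) hx]
  refine Finset.sum_congr rfl fun A _ => ?_
  rw [pd_sum (fun B _ => sB A B) hx]
  refine Finset.sum_congr rfl fun B _ => ?_
  rw [pd_const_mul _ ((hf.pd B).pd A) hx, pd_comm (hf.pd B) hx,
    pd_congr (fun y hy => pd_comm hf hy C B) hx]

variable {hInv}

lemma lap_mul (hiSymm : ∀ A B, hInv A B = hInv B A) (hf : SmoothOffZero f)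
    (hg : SmoothOffZero g) (hx : x ≠ 0) :
    lap hInv (fun y => f y * g y) x = f x * lap hInv g x + g x * lap hInv f x
      + 2 * ∑ A, ∑ B, hInv A B * pd A f x * pd B g x := by
  have hs : ∑ A, ∑ B, hInv A B * pd A f x * pd B g x
      = ∑ A, ∑ B, hInv A B * pd B f x * pd A g x := by
    rw [Finset.sum_comm]
    exact Finset.sum_congr rfl fun A _ => Finset.sum_congr rfl fun B _ => by rw [hiSymm]
  rw [two_mul]
  nth_rewrite 2 [hs]
  simp only [lap, Finset.mul_sum, ← Finset.sum_add_distrib]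
  refine Finset.sum_congr rfl fun A _ => Finset.sum_congr rfl fun B _ => ?_
  rw [pd_congr (fun y hy => pd_mul hf hg hy B) hx,
    pd_add (hf.mul (hg.pd B)) (hg.mul (hf.pd B)) hx, pd_mul hf (hg.pd B) hx,
    pd_mul hg (hf.pd B) hx]
  ring

end Calculus

section Metric

variable {N : ℕ} {h hInv : Matrix (Fin N) (Fin N) ℝ} {f : (Fin N → ℝ) → ℝ} {x : Fin N → ℝ}

lemma inv_symm (hSymm : ∀ A B, h A B = h B A) (hInvh : h * hInv = 1) (A B : Fin N) :
    hInv A B = hInv B A := by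
  have ht : h.transpose = h := by ext A B; exact hSymm B A
  have hi : hInv = h⁻¹ := (Matrix.inv_eq_right_inv hInvh).symm
  have : hInv.transpose = hInv := by rw [hi, Matrix.transpose_nonsing_inv, ht]
  exact congrFun (congrFun this B) A

lemma sum_mul_inv (hInvh : h * hInv = 1) (A C : Fin N) :
    ∑ B, h A B * hInv B C = if A = C then 1 else 0 := by
  rw [← Matrix.one_apply, ← hInvh, Matrix.mul_apply]

lemma sum_inv_mul (hInvh : h * hInv = 1) (A C : Fin N) :
    ∑ B, hInv A B * h B C = if A = C then 1 else 0 := by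
  rw [← Matrix.one_apply, ← mul_eq_one_comm.mp hInvh, Matrix.mul_apply]

lemma sum_inv_mul_Xc (hInvh : h * hInv = 1) (A : Fin N) :
    ∑ B, hInv A B * Xc h B x = x A := by
  simp only [Xc, Finset.mul_sum]
  rw [Finset.sum_comm]
  simp only [← mul_assoc, ← Finset.sum_mul, sum_inv_mul hInvh]
  simp

lemma lap_Xc (hx : x ≠ 0) (C : Fin N) : lap hInv (Xc h C) x = 0 := by
  simp only [lap]
  refine Finset.sum_eq_zero fun A _ => Finset.sum_eq_zero fun B _ => ?_
  rw [pd_congr (fun y hy => pd_Xc h hy B C) hx]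
  simp

lemma lap_Qfun (hSymm : ∀ A B, h A B = h B A) (hInvh : h * hInv = 1) (hx : x ≠ 0) :
    lap hInv (Qfun h) x = 2 * N := by
  have : ∀ A B, hInv A B * pd A (pd B (Qfun h)) x = 2 * (hInv A B * h B A) := fun A B => by
    rw [pd_congr (fun y hy => pd_Qfun hSymm hy B) hx, pd_const_mul _ (.xc h B) hx, pd_Xc h hx]
    ring
  simp only [lap, this, ← Finset.mul_sum, sum_inv_mul hInvh]
  simp

lemma lap_Xc_mul (hSymm : ∀ A B, h A B = h B A) (hInvh : h * hInv = 1) (hf : SmoothOffZero f)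
    (hx : x ≠ 0) (C : Fin N) :
    lap hInv (fun y => Xc h C y * f y) x = Xc h C x * lap hInv f x + 2 * pd C f x := by
  rw [lap_mul (inv_symm hSymm hInvh) (.xc h C) hf hx, lap_Xc hx]
  simp only [pd_Xc h hx]
  rw [Finset.sum_comm]
  simp only [mul_comm (hInv _ _), ← Finset.sum_mul, sum_mul_inv hInvh]
  simp

lemma lap_Qfun_mul (hSymm : ∀ A B, h A B = h B A) (hInvh : h * hInv = 1)
    (hf : SmoothOffZero f) (hx : x ≠ 0) :
    lap hInv (fun y => Qfun h y * f y) x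
      = Qfun h x * lap hInv f x + 2 * N * f x + 4 * ∑ A, x A * pd A f x := by
  rw [lap_mul (inv_symm hSymm hInvh) (.qfun h) hf hx, lap_Qfun hSymm hInvh hx]
  have : ∑ A, ∑ B, hInv A B * pd A (Qfun h) x * pd B f x = 2 * ∑ A, x A * pd A f x := by
    rw [Finset.sum_comm, Finset.mul_sum]
    refine Finset.sum_congr rfl fun B _ => ?_
    rw [← Finset.sum_mul, ← sum_inv_mul_Xc (x := x) hInvh B, ← mul_assoc, Finset.mul_sum]
    congr 1
    refine Finset.sum_congr rfl fun A _ => ?_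
    rw [pd_Qfun hSymm hx, inv_symm hSymm hInvh]
    ring
  rw [this]
  ring

end Metric

namespace Homog

variable {N : ℕ} {f g : (Fin N → ℝ) → ℝ} {v w : ℝ}

lemma add (hf : Homog w f) (hg : Homog w g) (sf : SmoothOffZero f) (sg : SmoothOffZero g) :
    Homog w (fun x => f x + g x) := fun x hx => by
  simp only [pd_add sf sg hx, mul_add, Finset.sum_add_distrib, hf x hx, hg x hx]

lemma const_mul (c : ℝ) (hf : Homog w f) (sf : SmoothOffZero f) :
    Homog w (fun x => c * f x) := fun x hx => by
  simp only [pd_const_mul c sf hx, mul_left_comm _ c, ← Finset.mul_sum, hf x hx]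

lemma mul (hf : Homog v f) (hg : Homog w g) (sf : SmoothOffZero f) (sg : SmoothOffZero g) :
    Homog (v + w) (fun x => f x * g x) := fun x hx => by
  simp only [pd_mul sf sg hx, mul_add, Finset.sum_add_distrib, mul_left_comm _ (f x),
    mul_left_comm _ (g x), ← Finset.mul_sum, hf x hx, hg x hx]
  ring

lemma sub (hf : Homog w f) (hg : Homog w g) (sf : SmoothOffZero f) (sg : SmoothOffZero g) :
    Homog w (fun x => f x - g x) := by
  have : (fun x => f x - g x) = fun x => f x + (-1) * g x := by ext; ring
  rw [this]
  exact hf.add (hg.const_mul _ sg) sf ((SmoothOffZero.const _).mul sg)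

lemma sum {ι : Type*} {s : Finset ι} {F : ι → (Fin N → ℝ) → ℝ}
    (hF : ∀ i ∈ s, Homog w (F i)) (sF : ∀ i ∈ s, SmoothOffZero (F i)) :
    Homog w (fun x => ∑ i ∈ s, F i x) := fun x hx => by
  simp only [pd_sum sF hx, Finset.mul_sum]
  rw [Finset.sum_comm]
  exact Finset.sum_congr rfl fun i hi => hF i hi x hx

lemma xc (h : Matrix (Fin N) (Fin N) ℝ) (A : Fin N) : Homog 1 (Xc h A) := fun x hx => by
  simp only [pd_Xc h hx, Xc, one_mul, mul_comm]

lemma pd (hf : Homog w f) (sf : SmoothOffZero f) (A : Fin N) : Homog (w - 1) (pd A f) :=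
  fun x hx => by
  have key := pd_congr hf hx A
  rw [pd_const_mul w sf hx,
    pd_sum (fun B _ => (SmoothOffZero.coord B).mul (sf.pd B)) hx] at key
  simp only [pd_mul (SmoothOffZero.coord _) (sf.pd _) hx, pd_coord, Finset.sum_add_distrib,
    pd_comm sf hx A] at key
  simp at key
  linarith

lemma lap (hf : Homog w f) (sf : SmoothOffZero f) (hInv : Matrix (Fin N) (Fin N) ℝ) :
    Homog (w - 2) (lap hInv f) := by
  have : w - 2 = w - 1 - 1 := by ring
  rw [this]
  exact sum (fun A _ => sum (fun B _ => ((hf.pd sf B).pd (sf.pd B) A).const_mul _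
      ((sf.pd B).pd A)) fun B _ => (SmoothOffZero.const _).mul ((sf.pd B).pd A))
    fun A _ => .sum fun B _ => (SmoothOffZero.const _).mul ((sf.pd B).pd A)

lemma lap_iterate (hf : Homog w f) (sf : SmoothOffZero f) (hInv : Matrix (Fin N) (Fin N) ℝ)
    (m : ℕ) : Homog (w - 2 * m) ((_root_.lap hInv)^[m] f) := by
  induction m with
  | zero => simpa using hf
  | succ m ih =>
    rw [Function.iterate_succ_apply']
    have : w - 2 * ((m + 1 : ℕ) : ℝ) = w - 2 * m - 2 := by push_cast; ring
    rw [this]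
    exact ih.lap (sf.lap_iterate hInv m) hInv

lemma dop (hf : Homog v f) (sf : SmoothOffZero f) (n : ℕ)
    (h hInv : Matrix (Fin N) (Fin N) ℝ) (w : ℝ) (A : Fin N) :
    Homog (v - 1) (Dop n h hInv w f A) := by
  have hX : Homog (v - 1) (fun x => Xc h A x * _root_.lap hInv f x) := by
    have : v - 1 = 1 + (v - 2) := by ring
    rw [this]
    exact (xc h A).mul (hf.lap sf hInv) (.xc h A) (sf.lap hInv)
  exact ((hf.pd sf A).const_mul _ (sf.pd A)).sub hX ((SmoothOffZero.const _).mul (sf.pd A))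
    ((SmoothOffZero.xc h A).mul (sf.lap hInv))

end Homog

section TractorD

variable {N : ℕ} {h hInv : Matrix (Fin N) (Fin N) ℝ} {f g : (Fin N → ℝ) → ℝ}
  {x : Fin N → ℝ}

lemma Dop_congr (n : ℕ) (w : ℝ) (hfg : ∀ y : Fin N → ℝ, y ≠ 0 → f y = g y) (hx : x ≠ 0)
    (A : Fin N) : Dop n h hInv w f A x = Dop n h hInv w g A x := by
  simp only [Dop, pd_congr hfg hx, lap_congr hInv hfg hx]

lemma Dop_add (n : ℕ) (w : ℝ) (hf : SmoothOffZero f) (hg : SmoothOffZero g) (hx : x ≠ 0)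
    (A : Fin N) : Dop n h hInv w (fun y => f y + g y) A x
      = Dop n h hInv w f A x + Dop n h hInv w g A x := by
  simp only [Dop, pd_add hf hg hx, lap_add hInv hf hg hx]
  ring

lemma lap_iterate_Dop (hSymm : ∀ A B, h A B = h B A) (hInvh : h * hInv = 1)
    (hf : SmoothOffZero f) (n : ℕ) (w : ℝ) (A : Fin N) (m : ℕ) (hx : x ≠ 0) :
    (lap hInv)^[m] (Dop n h hInv w f A) x
      = ((n : ℝ) + 2 * w - 2 - 2 * m) * pd A ((lap hInv)^[m] f) x
        - Xc h A x * (lap hInv)^[m + 1] f x := by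
  induction m generalizing x with
  | zero => simp [Dop]
  | succ m ih =>
    have hm := hf.lap_iterate hInv m
    have hm' := hf.lap_iterate hInv (m + 1)
    rw [Function.iterate_succ_apply', lap_congr hInv (fun y hy => ih hy) hx,
      lap_sub hInv ((SmoothOffZero.const _).mul (hm.pd A)) ((SmoothOffZero.xc h A).mul hm') hx,
      lap_const_mul hInv _ (hm.pd A) hx, lap_Xc_mul hSymm hInvh hm' hx, ← pd_lap hInv hm hx]
    simp only [Function.iterate_succ_apply']
    push_cast
    ring

/-- The product `X_{A_1} ⋯ X_{A_j}`. -/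
def Xprod (h : Matrix (Fin N) (Fin N) ℝ) (A : ℕ → Fin N) : ℕ → (Fin N → ℝ) → ℝ
  | 0 => fun _ => 1
  | j + 1 => fun x => Xc h (A (j + 1)) x * Xprod h A j x

lemma SmoothOffZero.xprod (h : Matrix (Fin N) (Fin N) ℝ) (A : ℕ → Fin N) (j : ℕ) :
    SmoothOffZero (Xprod h A j) := by
  induction j with
  | zero => exact .const 1
  | succ j ih => exact (SmoothOffZero.xc h _).mul ih

lemma Homog.xprod (h : Matrix (Fin N) (Fin N) ℝ) (A : ℕ → Fin N) (j : ℕ) :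
    Homog j (Xprod h A j) := by
  induction j with
  | zero => intro x hx; simp [Xprod]
  | succ j ih =>
    rw [Nat.cast_succ, add_comm]
    exact (Homog.xc h _).mul ih (.xc h _) (.xprod h A j)

lemma Xprod_update (h : Matrix (Fin N) (Fin N) ℝ) (A : ℕ → Fin N) (B : Fin N) {i j : ℕ}
    (hij : j < i) : Xprod h (Function.update A i B) j = Xprod h A j := by
  induction j with
  | zero => rfl
  | succ j ih => simp only [Xprod, ih (by omega), Function.update_of_ne hij.ne]

lemma lap_iterate_seqD (hSymm : ∀ A B, h A B = h B A) (hInvh : h * hInv = 1)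
    (hf : SmoothOffZero f) (n : ℕ) (A : ℕ → Fin N) {j m k : ℕ} (hjm : j + m = k)
    (hx : x ≠ 0) :
    (lap hInv)^[m] (seqD n h hInv ((k : ℝ) - (n : ℝ) / 2) f A j) x
      = (-1) ^ j * Xprod h A j x * (lap hInv)^[k] f x := by
  induction j generalizing m with
  | zero =>
    obtain rfl : m = k := by omega
    simp [seqD, Xprod]
  | succ j ih =>
    have hc : (n : ℝ) + 2 * ((k : ℝ) - n / 2 - j) - 2 - 2 * m = 0 := by
      rw [← hjm]; push_cast; ring
    rw [seqD, lap_iterate_Dop hSymm hInvh (hf.seqD n h hInv _ A j) n _ _ m hx, hc,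
      ih (m := m + 1) (by omega), Xprod]
    ring

lemma Dop_Qfun_mul {n : ℕ} {h hInv : Matrix (Fin (n + 2)) (Fin (n + 2)) ℝ}
    {g : (Fin (n + 2) → ℝ) → ℝ} {x : Fin (n + 2) → ℝ} {w : ℝ}
    (hSymm : ∀ A B, h A B = h B A) (hInvh : h * hInv = 1) (sg : SmoothOffZero g)
    (hg : Homog (w - 2) g) (hx : x ≠ 0) (C : Fin (n + 2)) :
    Dop n h hInv w (fun y => Qfun h y * g y) C x = Qfun h x * Dop n h hInv w g C x := by
  simp only [Dop]
  rw [pd_mul (.qfun h) sg hx, pd_Qfun hSymm hx, lap_Qfun_mul hSymm hInvh sg hx, hg x hx]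
  push_cast
  ring

lemma sum_inv_mul_Dop_Xc_mul {n : ℕ} {h hInv : Matrix (Fin (n + 2)) (Fin (n + 2)) ℝ}
    {ψ : (Fin (n + 2) → ℝ) → ℝ} {x : Fin (n + 2) → ℝ} {w : ℝ}
    (hSymm : ∀ A B, h A B = h B A) (hInvh : h * hInv = 1) (sψ : SmoothOffZero ψ)
    (hψ : Homog (w - 1) ψ) (hx : x ≠ 0) :
    ∑ B, ∑ C, hInv B C * Dop n h hInv w (fun y => Xc h B y * ψ y) C x
      = ((n : ℝ) + 2 * w) * (n + w - 1) * ψ x - Qfun h x * lap hInv ψ x := by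
  have expand : ∀ B C, hInv B C * Dop n h hInv w (fun y => Xc h B y * ψ y) C x
      = ((n : ℝ) + 2 * w - 2) * ψ x * (hInv B C * h C B)
        + ((n : ℝ) + 2 * w - 2) * (hInv C B * Xc h B x * pd C ψ x)
        - 2 * (hInv B C * Xc h C x * pd B ψ x)
        - lap hInv ψ x * (Xc h B x * (hInv B C * Xc h C x)) := fun B C => by
    simp only [Dop]
    rw [pd_mul (.xc h B) sψ hx, pd_Xc h hx, lap_Xc_mul hSymm hInvh sψ hx, hSymm B C,
      inv_symm hSymm hInvh C B]
    ring
  simp only [expand, Finset.sum_add_distrib, Finset.sum_sub_distrib, ← Finset.mul_sum,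
    sum_inv_mul hInvh]
  rw [Finset.sum_comm (f := fun B C => hInv C B * Xc h B x * pd C ψ x)]
  simp only [← Finset.sum_mul, sum_inv_mul_Xc hInvh, hψ x hx]
  have hQ : ∑ B, Xc h B x * x B = Qfun h x := by
    simp only [Qfun_eq_sum_mul_Xc, mul_comm]
  rw [hQ]
  simp
  ring

/-- After `i` contractions one is left with a multiple of `X_{A_1} ⋯ X_{A_j} Δ^k f`, where
`j = k - 1 - i`, up to `Q` times a smooth homogeneous function. -/
lemma Vseq_eq {n : ℕ} {h hInv : Matrix (Fin (n + 2)) (Fin (n + 2)) ℝ}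
    (hSymm : ∀ A B, h A B = h B A) (hInvh : h * hInv = 1) {k : ℕ}
    {f : (Fin (n + 2) → ℝ) → ℝ} (hf : SmoothOffZero f)
    (hhom : Homog ((k : ℝ) - (n : ℝ) / 2) f) {i j : ℕ} (hij : i + j + 1 = k)
    (A : ℕ → Fin (n + 2)) :
    ∃ g : (Fin (n + 2) → ℝ) → ℝ, SmoothOffZero g ∧ Homog (-1 - (i : ℝ) - (n : ℝ) / 2 - 2) g ∧
      ∀ x : Fin (n + 2) → ℝ, x ≠ 0 → Vseq n k h hInv f i A x
        = (-1) ^ j * (∏ l ∈ Finset.Icc 2 (i + 1), (((n : ℝ) - 2 * (l : ℝ)) * ((l : ℝ) - 1)))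
            * Xprod h A j x * (lap hInv)^[k] f x + Qfun h x * g x := by
  induction i generalizing j A with
  | zero =>
    refine ⟨fun _ => 0, .const 0, fun x _ => by simp, fun x hx => ?_⟩
    have := lap_iterate_seqD hSymm hInvh hf n A (j := j) (m := 1) (by omega : j + 1 = k) hx
    obtain rfl : j = k - 1 := by omega
    simpa [Vseq] using this
  | succ i ih =>
    set w : ℝ := -1 - (i : ℝ) - (n : ℝ) / 2 with hw
    set c : ℝ := ∏ l ∈ Finset.Icc 2 (i + 1), (((n : ℝ) - 2 * (l : ℝ)) * ((l : ℝ) - 1)) with hc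
    have hk : k - 1 - i = j + 1 := by omega
    choose g sg hg eg using fun B => ih (j := j + 1) (by omega) (Function.update A (j + 1) B)
    set φ := (lap hInv)^[k] f
    have sφ : SmoothOffZero φ := hf.lap_iterate hInv k
    set ψ : (Fin (n + 2) → ℝ) → ℝ := fun x => (-1) ^ (j + 1) * c * (Xprod h A j x * φ x)
    have sXφ := (SmoothOffZero.xprod h A j).mul sφ
    have sψ : SmoothOffZero ψ := (SmoothOffZero.const _).mul sXφ
    have hψ : Homog (w - 1) ψ := by
      have : w - 1 = j + ((k : ℝ) - n / 2 - 2 * k) := by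
        rw [hw, ← hij]; push_cast; ring
      rw [this]
      exact ((Homog.xprod h A j).mul (hhom.lap_iterate hf hInv k) (.xprod h A j)
        sφ).const_mul _ sXφ
    have sD : ∀ B C, SmoothOffZero (fun x => hInv B C * Dop n h hInv w (g B) C x) :=
      fun B C => (SmoothOffZero.const _).mul ((sg B).dop n h hInv w C)
    have sS : SmoothOffZero (fun x => ∑ B, ∑ C, hInv B C * Dop n h hInv w (g B) C x) :=
      .sum fun B _ => .sum fun C _ => sD B C
    have hweight : -1 - ((i + 1 : ℕ) : ℝ) - (n : ℝ) / 2 - 2 = w - 2 - 1 := by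
      rw [hw]; push_cast; ring
    refine ⟨fun x => (∑ B, ∑ C, hInv B C * Dop n h hInv w (g B) C x) - lap hInv ψ x,
      sS.sub (sψ.lap hInv), ?_, fun x hx => ?_⟩
    · rw [hweight]
      refine Homog.sub (.sum (fun B _ => .sum (fun C _ => ?_) fun C _ => sD B C)
        fun B _ => .sum fun C _ => sD B C) ?_ sS (sψ.lap hInv)
      · exact ((hg B).dop (sg B) n h hInv w C).const_mul _ ((sg B).dop n h hInv w C)
      · rw [sub_right_comm]
        exact hψ.lap sψ hInv
    · have step : ∀ B C, hInv B C *
          Dop n h hInv w (Vseq n k h hInv f i (Function.update A (k - 1 - i) B)) C x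
          = hInv B C * Dop n h hInv w (fun y => Xc h B y * ψ y) C x
            + Qfun h x * (hInv B C * Dop n h hInv w (g B) C x) := fun B C => by
        have e : ∀ y : Fin (n + 2) → ℝ, y ≠ 0 →
            Vseq n k h hInv f i (Function.update A (k - 1 - i) B) y
              = Xc h B y * ψ y + Qfun h y * g B y := fun y hy => by
          rw [hk, eg B y hy, Xprod, Xprod_update h A B (Nat.lt_succ_self j),
            Function.update_self]
          ring
        rw [Dop_congr n w e hx, Dop_add n w ((SmoothOffZero.xc h B).mul sψ)
          ((SmoothOffZero.qfun h).mul (sg B)) hx, Dop_Qfun_mul hSymm hInvh (sg B) (hg B) hx]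
        ring
      simp only [Vseq]
      rw [← hw]
      simp only [step, Finset.sum_add_distrib, ← Finset.mul_sum]
      rw [sum_inv_mul_Dop_Xc_mul hSymm hInvh sψ hψ hx,
        Finset.prod_Icc_succ_top (by omega : 2 ≤ i + 1 + 1), ← hc]
      simp only [ψ, hw]
      push_cast
      ring

end TractorD

/-- Eastwood's formula (defboxk) in the flat model: the full contraction
`D^{A_1}⋯D^{A_{k−1}} Δ D_{A_{k−1}}⋯D_{A_1} f` equals
`(∏_{i=2}^{k} (n−2i)(i−1)) Δ^k f` up to a term divisible by `Q`. -/
theorem eastwood_formula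
    (n : ℕ) (hn : 1 ≤ n)
    (h hInv : Matrix (Fin (n + 2)) (Fin (n + 2)) ℝ)
    (hSymm : ∀ A B, h A B = h B A) (hInvh : h * hInv = 1)
    (k : ℕ) (hk : 1 ≤ k)
    (f : (Fin (n + 2) → ℝ) → ℝ) (hf : SmoothOffZero f)
    (hhom : Homog ((k : ℝ) - (n : ℝ) / 2) f)
    (A : ℕ → Fin (n + 2)) :
    ∃ g : (Fin (n + 2) → ℝ) → ℝ, SmoothOffZero g ∧
      ∀ x : Fin (n + 2) → ℝ, x ≠ 0 →
        Vseq n k h hInv f (k - 1) A x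
          = (∏ i ∈ Finset.Icc 2 k, (((n : ℝ) - 2 * (i : ℝ)) * ((i : ℝ) - 1)))
              * (lap hInv)^[k] f x
            + Qfun h x * g x := by
  obtain ⟨g, sg, -, eg⟩ := Vseq_eq hSymm hInvh hf hhom (i := k - 1) (j := 0) (by omega) A
  refine ⟨g, sg, fun x hx => ?_⟩
  simpa [Xprod, Nat.sub_add_cancel hk] using eg x hx
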